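/- arXiv:2105.03598 — 4 statements merged into one kernel-verified Lean document; each statement's English description precedes it below -/
import Mathlib

section
/- Let 0 < σ_min ≤ σ_max and let σ₁², σ₂² ∈ [σ_min², σ_max²]. Then for every real μ, the total variation distance between the Gaussian distributions N(μ, σ₁²) and N(μ, σ₂²) satisfies Λ_TV(N(μ, σ₁²), N(μ, σ₂²)) ≤ |σ₁² − σ₂²| / (√(2π) · σ_min²). -/
open MeasureTheory ProbabilityTheory

/-- Total variation distance between two measures on `ℝ`:
`Λ_TV(μ, ν) = sup_{A measurable} |μ(A) - ν(A)|`. -/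
noncomputable def tvDist (μ ν : Measure ℝ) : ℝ :=
  ⨆ A : {s : Set ℝ // MeasurableSet s}, |(μ A).toReal - (ν A).toReal|

/-- The gap between two Gaussian densities with a common mean is largest there. -/
lemma gaussianPDFReal_sub_le_sub_at_mean (μ : ℝ) {v w : NNReal} (hv : 0 < v) (hvw : v ≤ w)
    (x : ℝ) :
    gaussianPDFReal μ v x - gaussianPDFReal μ w x
      ≤ (√(2 * Real.pi * v))⁻¹ - (√(2 * Real.pi * w))⁻¹ := by
  have hv' : (0 : ℝ) < v := by exact_mod_cast hv
  have hvw' : (v : ℝ) ≤ w := by exact_mod_cast hvw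
  have hw' : (0 : ℝ) < w := hv'.trans_le hvw'
  simp only [gaussianPDFReal]
  have hcoef : (√(2 * Real.pi * w))⁻¹ ≤ (√(2 * Real.pi * v))⁻¹ := by gcongr
  have hexp : Real.exp (-(x - μ) ^ 2 / (2 * v)) ≤ Real.exp (-(x - μ) ^ 2 / (2 * w)) := by
    rw [neg_div, neg_div]
    gcongr
  have hone : Real.exp (-(x - μ) ^ 2 / (2 * w)) ≤ 1 := by
    rw [Real.exp_le_one_iff, neg_div]
    exact neg_nonpos.2 (by positivity)
  have hpos : 0 ≤ (√(2 * Real.pi * v))⁻¹ := by positivity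
  nlinarith [mul_le_mul_of_nonneg_left hexp hpos,
    mul_nonneg (sub_nonneg.2 hcoef) (sub_nonneg.2 hone)]

/-- Beyond the larger standard deviation, the wider Gaussian density dominates. -/
lemma gaussianPDFReal_le_of_var_le_sq (μ : ℝ) {v w : NNReal} (hv : 0 < v) (hvw : v ≤ w)
    {x : ℝ} (hx : (w : ℝ) ≤ (x - μ) ^ 2) :
    gaussianPDFReal μ v x ≤ gaussianPDFReal μ w x := by
  have hv' : (0 : ℝ) < v := by exact_mod_cast hv
  have hvw' : (v : ℝ) ≤ w := by exact_mod_cast hvw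
  have hw' : (0 : ℝ) < w := hv'.trans_le hvw'
  have hratio : √((w : ℝ) / v) ≤ Real.exp ((w / v - 1) / 2) := by
    rw [Real.exp_half]
    apply Real.sqrt_le_sqrt
    linarith [Real.add_one_le_exp ((w : ℝ) / v - 1)]
  have hexponent : ((w : ℝ) / v - 1) / 2 + -(x - μ) ^ 2 / (2 * v) ≤ -(x - μ) ^ 2 / (2 * w) := by
    have key : -(x - μ) ^ 2 / (2 * w) - (((w : ℝ) / v - 1) / 2 + -(x - μ) ^ 2 / (2 * v))
        = (w - v) * ((x - μ) ^ 2 - w) / (2 * v * w) := by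
      field_simp
      ring
    have : 0 ≤ ((w : ℝ) - v) * ((x - μ) ^ 2 - w) / (2 * v * w) :=
      div_nonneg (mul_nonneg (by linarith) (by linarith)) (by positivity)
    linarith
  have hcoef : (√(2 * Real.pi * v))⁻¹ = (√(2 * Real.pi * w))⁻¹ * √((w : ℝ) / v) := by
    rw [← Real.sqrt_inv, ← Real.sqrt_inv, ← Real.sqrt_mul (by positivity)]
    congr 1
    field_simp
  simp only [gaussianPDFReal]
  rw [hcoef, mul_assoc]
  gcongr
  calc √((w : ℝ) / v) * Real.exp (-(x - μ) ^ 2 / (2 * v))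
      ≤ Real.exp ((w / v - 1) / 2) * Real.exp (-(x - μ) ^ 2 / (2 * v)) := by gcongr
    _ ≤ Real.exp (-(x - μ) ^ 2 / (2 * w)) := by
      rw [← Real.exp_add]
      exact Real.exp_le_exp.2 hexponent

lemma gaussianReal_toReal_sub_le (μ : ℝ) {v w : NNReal} (hv : 0 < v) (hvw : v ≤ w)
    (A : Set ℝ) :
    (gaussianReal μ v A).toReal - (gaussianReal μ w A).toReal
      ≤ 2 * √w * ((√(2 * Real.pi * v))⁻¹ - (√(2 * Real.pi * w))⁻¹) := by
  have hv' : (0 : ℝ) < v := by exact_mod_cast hv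
  have hvw' : (v : ℝ) ≤ w := by exact_mod_cast hvw
  set c : ℝ := (√(2 * Real.pi * v))⁻¹ - (√(2 * Real.pi * w))⁻¹
  have hc0 : 0 ≤ c := sub_nonneg.2 (by gcongr)
  set I : Set ℝ := Set.Icc (μ - √w) (μ + √w)
  have hint : Integrable (I.indicator fun _ => c) :=
    (integrable_indicator_iff measurableSet_Icc).2
      (integrableOn_const (by rw [Real.volume_Icc]; exact ENNReal.ofReal_ne_top))
  have happly (u : NNReal) (hu : u ≠ 0) :
      (gaussianReal μ u A).toReal = ∫ x in A, gaussianPDFReal μ u x := by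
    rw [gaussianReal_apply_eq_integral μ hu,
      ENNReal.toReal_ofReal (integral_nonneg fun x => gaussianPDFReal_nonneg μ u x)]
  rw [happly v hv.ne', happly w (hv.trans_le hvw).ne',
    ← integral_sub (integrable_gaussianPDFReal μ v).integrableOn
      (integrable_gaussianPDFReal μ w).integrableOn]
  calc ∫ x in A, (gaussianPDFReal μ v x - gaussianPDFReal μ w x)
      ≤ ∫ x in A, I.indicator (fun _ => c) x := by
        refine integral_mono ((integrable_gaussianPDFReal μ v).sub
          (integrable_gaussianPDFReal μ w)).integrableOn hint.integrableOn fun x => ?_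
        by_cases hx : x ∈ I
        · simpa only [Set.indicator_of_mem hx] using
            gaussianPDFReal_sub_le_sub_at_mean μ hv hvw x
        · simp only [Set.indicator_of_notMem hx]
          refine sub_nonpos.2 (gaussianPDFReal_le_of_var_le_sq μ hv hvw ?_)
          by_contra! h
          have := abs_le.1 (Real.abs_le_sqrt h.le)
          exact hx ⟨by linarith, by linarith⟩
    _ ≤ ∫ x, I.indicator (fun _ => c) x :=
        setIntegral_le_integral hint
          (Filter.Eventually.of_forall fun x => Set.indicator_nonneg (fun _ _ => hc0) x)
    _ = 2 * √w * c := by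
        rw [integral_indicator measurableSet_Icc, setIntegral_const, Real.volume_real_Icc_of_le
          (by linarith [Real.sqrt_nonneg (w : ℝ)]), smul_eq_mul]
        ring

lemma two_mul_sqrt_mul_inv_sqrt_sub_le {v w m : ℝ} (hm : 0 < m) (hmv : m ≤ v) (hvw : v ≤ w) :
    2 * √w * ((√(2 * Real.pi * v))⁻¹ - (√(2 * Real.pi * w))⁻¹)
      ≤ (w - v) / (√(2 * Real.pi) * m) := by
  have hv : 0 < v := hm.trans_le hmv
  have hw : 0 < w := hv.trans_le hvw
  have hs : 0 < √v := Real.sqrt_pos.2 hv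
  have ht : 0 < √w := Real.sqrt_pos.2 hw
  have hp : 0 < √(2 * Real.pi) := by positivity
  rw [Real.sqrt_mul (by positivity) v, Real.sqrt_mul (by positivity) w]
  calc 2 * √w * ((√(2 * Real.pi) * √v)⁻¹ - (√(2 * Real.pi) * √w)⁻¹)
      = 2 * √v * (√w - √v) / (√(2 * Real.pi) * √v ^ 2) := by field_simp
    _ ≤ (w - v) / (√(2 * Real.pi) * √v ^ 2) := by
        gcongr
        nlinarith [Real.sq_sqrt hv.le, Real.sq_sqrt hw.le, sq_nonneg (√w - √v)]
    _ ≤ (w - v) / (√(2 * Real.pi) * m) := by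
        rw [Real.sq_sqrt hv.le]
        have := sub_nonneg.2 hvw
        gcongr

lemma abs_gaussianReal_toReal_sub_le (μ : ℝ) {m : ℝ} (hm : 0 < m) {v w : NNReal}
    (hmv : m ≤ v) (hvw : v ≤ w) {A : Set ℝ} (hA : MeasurableSet A) :
    |(gaussianReal μ v A).toReal - (gaussianReal μ w A).toReal|
      ≤ ((w : ℝ) - v) / (√(2 * Real.pi) * m) := by
  have hv : 0 < v := by exact_mod_cast hm.trans_le hmv
  have hbound (B : Set ℝ) := (gaussianReal_toReal_sub_le μ hv hvw B).trans
    (two_mul_sqrt_mul_inv_sqrt_sub_le hm hmv (by exact_mod_cast hvw))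
  have hcompl (u : NNReal) :
      (gaussianReal μ u Aᶜ).toReal = 1 - (gaussianReal μ u A).toReal :=
    probReal_compl_eq_one_sub hA
  have hAc := hbound Aᶜ
  rw [hcompl v, hcompl w] at hAc
  exact abs_le.2 ⟨by linarith, hbound A⟩

/-- If `0 < σ_min ≤ σ_max` and the variances `v₁, v₂` lie in `[σ_min², σ_max²]`, then for
every mean `μ`, `Λ_TV(N(μ, v₁), N(μ, v₂)) ≤ |v₁ - v₂| / (√(2π) σ_min²)`. -/
theorem tv_gaussian_variance_bound
    (σmin σmax : ℝ) (hmin : 0 < σmin) (hminmax : σmin ≤ σmax)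
    (v₁ v₂ : NNReal)
    (hv₁ : σmin ^ 2 ≤ (v₁ : ℝ) ∧ (v₁ : ℝ) ≤ σmax ^ 2)
    (hv₂ : σmin ^ 2 ≤ (v₂ : ℝ) ∧ (v₂ : ℝ) ≤ σmax ^ 2)
    (μ : ℝ) :
    tvDist (gaussianReal μ v₁) (gaussianReal μ v₂)
      ≤ |(v₁ : ℝ) - (v₂ : ℝ)| / (Real.sqrt (2 * Real.pi) * σmin ^ 2) := by
  have hm : 0 < σmin ^ 2 := by positivity
  have : Nonempty {s : Set ℝ // MeasurableSet s} := ⟨⟨∅, MeasurableSet.empty⟩⟩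
  refine ciSup_le fun A => ?_
  rcases le_total v₁ v₂ with h | h
  · have h' : (v₁ : ℝ) ≤ v₂ := by exact_mod_cast h
    rw [abs_sub_comm (v₁ : ℝ), abs_of_nonneg (sub_nonneg.2 h')]
    exact abs_gaussianReal_toReal_sub_le μ hm hv₁.1 h A.2
  · have h' : (v₂ : ℝ) ≤ v₁ := by exact_mod_cast h
    rw [abs_sub_comm, abs_of_nonneg (sub_nonneg.2 h')]
    exact abs_gaussianReal_toReal_sub_le μ hm hv₂.1 h A.2
end

section
/- For every real number s ≥ 1, the total variation distance between N(0,1) and N(0,s) satisfies Λ_TV(N(0,1), N(0,s)) ≤ (s − 1)/√(2π). -/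
open MeasureTheory ProbabilityTheory

/-- For `σ > 1`, the density of `N(0,1)` dominates that of `N(0,σ²)` exactly on a centered interval,
whose half-length `t` satisfies `2 * t ≤ σ * (σ + 1)`. -/
lemma exists_setOf_gaussianPDFReal_sub_nonneg_eq_Icc {σ : ℝ} (hσ : 1 < σ) :
    ∃ t : ℝ, 0 ≤ t ∧ 2 * t ≤ σ * (σ + 1) ∧
      {x | 0 ≤ gaussianPDFReal 0 1 x - gaussianPDFReal 0 (σ ^ 2).toNNReal x} =
        Set.Icc (-t) t := by
  have hσ0 : 0 < σ := by linarith
  have hlog : 0 < Real.log σ := Real.log_pos hσ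
  have hsq : 0 < σ ^ 2 - 1 := by nlinarith
  refine ⟨√(2 * σ ^ 2 * Real.log σ / (σ ^ 2 - 1)), Real.sqrt_nonneg _, ?_, ?_⟩
  · have h : √(2 * σ ^ 2 * Real.log σ / (σ ^ 2 - 1)) ≤ σ * (σ + 1) / 2 := by
      apply Real.sqrt_le_iff.2 ⟨by positivity, ?_⟩
      rw [div_le_iff₀ hsq]
      have hle : Real.log σ ≤ σ - 1 := Real.log_le_sub_one_of_pos hσ0
      have hcube : 8 * (σ - 1) ≤ (σ + 1) ^ 2 * (σ ^ 2 - 1) := by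
        have : 8 ≤ (σ + 1) ^ 3 := by
          calc (8 : ℝ) = 2 ^ 3 := by norm_num
            _ ≤ (σ + 1) ^ 3 := by gcongr; linarith
        nlinarith
      nlinarith [mul_le_mul_of_nonneg_left (hcube.trans' (mul_le_mul_of_nonneg_left hle
        (by norm_num : (0 : ℝ) ≤ 8))) (sq_nonneg σ)]
    linarith
  · ext x
    have hpdf : gaussianPDFReal 0 (σ ^ 2).toNNReal x =
        (√(2 * Real.pi))⁻¹ * Real.exp (-Real.log σ - x ^ 2 / (2 * σ ^ 2)) := by
      rw [gaussianPDFReal, Real.coe_toNNReal _ (sq_nonneg σ), Real.sqrt_mul (by positivity),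
        Real.sqrt_sq hσ0.le, mul_inv, sub_zero, sub_eq_add_neg, Real.exp_add,
        Real.exp_neg (Real.log σ), Real.exp_log hσ0, neg_div, mul_assoc]
    have hpdf_one : gaussianPDFReal 0 1 x = (√(2 * Real.pi))⁻¹ * Real.exp (-x ^ 2 / 2) := by
      simp [gaussianPDFReal]
    rw [Set.mem_ofPred_eq, sub_nonneg, hpdf, hpdf_one, mul_le_mul_iff_right₀ (by positivity),
      Real.exp_le_exp, Set.mem_Icc, ← abs_le, ← Real.sqrt_sq_eq_abs,
      Real.sqrt_le_sqrt_iff (by positivity), le_div_iff₀ hsq]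
    have hdiv : x ^ 2 / (2 * σ ^ 2) * (2 * σ ^ 2) = x ^ 2 := by field_simp
    rw [← mul_le_mul_iff_left₀ (show 0 < 2 * σ ^ 2 by positivity), sub_mul, hdiv]
    constructor <;> intro h <;> nlinarith

lemma gaussianReal_real_eq_integral (μ : ℝ) {v : NNReal} (hv : v ≠ 0) (A : Set ℝ) :
    (gaussianReal μ v).real A = ∫ x in A, gaussianPDFReal μ v x := by
  rw [measureReal_def, gaussianReal_apply_eq_integral μ hv,
    ENNReal.toReal_ofReal (integral_nonneg (gaussianPDFReal_nonneg μ v))]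

/-- The standard Gaussian density is bounded by `1 / √(2π)`, which gives a bound of the
standard Gaussian measure by a multiple of Lebesgue measure. -/
lemma gaussianReal_real_le {A : Set ℝ} (hA : volume A ≠ ⊤) :
    (gaussianReal 0 1).real A ≤ volume.real A / √(2 * Real.pi) := by
  rw [gaussianReal_real_eq_integral 0 one_ne_zero]
  calc ∫ x in A, gaussianPDFReal 0 1 x ≤ ∫ _ in A, (√(2 * Real.pi))⁻¹ := by
        refine integral_mono (integrable_gaussianPDFReal 0 1).integrableOn
          (integrableOn_const hA) fun x ↦ ?_
        simp only [gaussianPDFReal, NNReal.coe_one, mul_one, sub_zero]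
        refine mul_le_of_le_one_right (by positivity) (Real.exp_le_one_iff.2 ?_)
        linarith [sq_nonneg x]
    _ = _ := by simp [div_eq_mul_inv]

lemma gaussianReal_sq_real_Icc {σ : ℝ} (hσ : 0 < σ) (t : ℝ) :
    (gaussianReal 0 (σ ^ 2).toNNReal).real (Set.Icc (-t) t) =
      (gaussianReal 0 1).real (Set.Icc (-(t / σ)) (t / σ)) := by
  have hmap : gaussianReal 0 (σ ^ 2).toNNReal = (gaussianReal 0 1).map (σ * ·) := by
    rw [gaussianReal_map_const_mul, mul_zero, mul_one]
    congr
    exact Real.toNNReal_of_nonneg (sq_nonneg σ)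
  rw [hmap, map_measureReal_apply (by fun_prop) measurableSet_Icc,
    Set.preimage_const_mul_Icc₀ _ _ hσ, neg_div]

lemma gaussianReal_real_sub_le {σ : ℝ} (hσ : 1 < σ) {A : Set ℝ} (hA : MeasurableSet A) :
    (gaussianReal 0 1).real A - (gaussianReal 0 (σ ^ 2).toNNReal).real A ≤
      (σ ^ 2 - 1) / √(2 * Real.pi) := by
  have hσ0 : 0 < σ := by linarith
  have hv : (σ ^ 2).toNNReal ≠ 0 := (Real.toNNReal_pos.2 (by positivity)).ne'
  have hsub (B : Set ℝ) :
      (gaussianReal 0 1).real B - (gaussianReal 0 (σ ^ 2).toNNReal).real B =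
        ∫ x in B, (gaussianPDFReal 0 1 x - gaussianPDFReal 0 (σ ^ 2).toNNReal x) := by
    rw [gaussianReal_real_eq_integral 0 one_ne_zero, gaussianReal_real_eq_integral 0 hv,
      integral_sub
      (integrable_gaussianPDFReal _ _).integrableOn (integrable_gaussianPDFReal _ _).integrableOn]
  obtain ⟨t, ht, htle, hset⟩ := exists_setOf_gaussianPDFReal_sub_nonneg_eq_Icc hσ
  have hdiv : t / σ ≤ t := div_le_self ht hσ.le
  have hdiv0 : 0 ≤ t / σ := by positivity
  have hsubset : Set.Icc (-(t / σ)) (t / σ) ⊆ Set.Icc (-t) t :=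
    Set.Icc_subset_Icc (neg_le_neg hdiv) hdiv
  calc (gaussianReal 0 1).real A - (gaussianReal 0 (σ ^ 2).toNNReal).real A
    _ ≤ (gaussianReal 0 1).real (Set.Icc (-t) t) -
        (gaussianReal 0 (σ ^ 2).toNNReal).real (Set.Icc (-t) t) := by
      rw [hsub, hsub, ← hset]
      exact setIntegral_le_nonneg hA
        ((stronglyMeasurable_gaussianPDFReal _ _).sub (stronglyMeasurable_gaussianPDFReal _ _))
        ((integrable_gaussianPDFReal _ _).sub (integrable_gaussianPDFReal _ _))
    _ = (gaussianReal 0 1).real (Set.Icc (-t) t \ Set.Icc (-(t / σ)) (t / σ)) := by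
      rw [gaussianReal_sq_real_Icc hσ0, measureReal_sdiff hsubset measurableSet_Icc]
    _ ≤ volume.real (Set.Icc (-t) t \ Set.Icc (-(t / σ)) (t / σ)) / √(2 * Real.pi) :=
      gaussianReal_real_le (measure_ne_top_of_subset Set.sdiff_subset measure_Icc_lt_top.ne)
    _ ≤ (σ ^ 2 - 1) / √(2 * Real.pi) := by
      gcongr
      rw [measureReal_sdiff hsubset measurableSet_Icc (by simp),
        Real.volume_real_Icc_of_le (by linarith), Real.volume_real_Icc_of_le (by linarith)]
      have hmul : t / σ * σ = t := by field_simp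
      nlinarith

/-- For every `s ≥ 1`, `Λ_TV(N(0,1), N(0,s)) ≤ (s - 1)/√(2π)`. -/
theorem tv_gaussian_le (s : ℝ) (hs : 1 ≤ s) :
    tvDist (gaussianReal 0 1) (gaussianReal 0 s.toNNReal)
      ≤ (s - 1) / Real.sqrt (2 * Real.pi) := by
  obtain rfl | hs := hs.eq_or_lt
  · simp [tvDist]
  have hσ : 1 < √s := Real.lt_sqrt_of_sq_lt (by simpa using hs)
  have hsq : √s ^ 2 = s := Real.sq_sqrt (by linarith)
  refine Real.iSup_le (fun ⟨A, hA⟩ ↦ ?_) (div_nonneg (by linarith) (Real.sqrt_nonneg _))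
  have hle := gaussianReal_real_sub_le hσ hA
  have hle_compl := gaussianReal_real_sub_le hσ hA.compl
  rw [hsq] at hle hle_compl
  rw [probReal_compl_eq_one_sub hA, probReal_compl_eq_one_sub hA] at hle_compl
  simp only [← measureReal_def]
  exact abs_le.2 ⟨by linarith, hle⟩
end

section
/- Let D be a probability distribution on [0,1] with density d satisfying |d(x) − d(y)| ≤ 2C|x − y| for all x, y ∈ [0,1], for a constant C > 0. Let r be a positive integer, ℓ = 1/r, and partition [0,1] into the bins I_1 = [0,ℓ], I_s = ((s−1)ℓ, sℓ] for s = 2, …, r. Let p_1, …, p_r be nonnegative reals summing to 1, and let p be the piecewise-constant density with p(z) = p_s/ℓ for z ∈ I_s. Then (1/2)·∫_0^1 |p(z) − d(z)| dz ≤ (1/2)·∑_{s=1}^r |p_s − ∫_{I_s} d(z) dz| + C·ℓ/4. -/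
open MeasureTheory

open scoped NNReal

/-- The part of an interval on which a `K`-Lipschitz function takes values in `(0, t]` has length at
least `t / K`, as soon as the function takes both a nonpositive value and a value above `t`. -/
theorem LipschitzWith.le_mul_measureReal_preimage_Ioc {K : ℝ≥0} {f : ℝ → ℝ}
    (hf : LipschitzWith K f) {a b c x t : ℝ}
    (hc : c ∈ Set.Ioc a b) (hfc : f c ≤ 0) (hx : x ∈ Set.Ioc a b) (hfx : t < f x) :
    t ≤ K * (volume.restrict (Set.Ioc a b)).real (f ⁻¹' Set.Ioc 0 t) := by
  have hmeas : MeasurableSet (f ⁻¹' Set.Ioc 0 t) := hf.continuous.measurable measurableSet_Ioc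
  have hsub : Set.Ioc 0 t ⊆ f '' (f ⁻¹' Set.Ioc 0 t ∩ Set.Ioc a b) := by
    intro y hy
    obtain ⟨z, hz, rfl⟩ := isPreconnected_Ioc.intermediate_value hc hx
      hf.continuous.continuousOn ⟨hfc.trans hy.1.le, hy.2.trans hfx.le⟩
    exact ⟨z, ⟨hy, hz⟩, rfl⟩
  have himage := (measure_mono hsub).trans (by
    simpa [hausdorffMeasure_real] using
      hf.hausdorffMeasure_image_le zero_le_one (f ⁻¹' Set.Ioc 0 t ∩ Set.Ioc a b))
  rw [← Measure.restrict_apply hmeas, Real.volume_Ioc, sub_zero] at himage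
  have htop : (K : ENNReal) * volume.restrict (Set.Ioc a b) (f ⁻¹' Set.Ioc 0 t) ≠ ⊤ :=
    ENNReal.mul_ne_top ENNReal.coe_ne_top (measure_ne_top _ _)
  simpa [Measure.real] using (ENNReal.ofReal_le_iff_le_toReal htop).1 himage

theorem integral_Ioi_max_sub_zero {M : ℝ} (hM : 0 ≤ M) :
    IntegrableOn (fun t => max (M - t) 0) (Set.Ioi 0) ∧
      ∫ t in Set.Ioi (0 : ℝ), max (M - t) 0 = M ^ 2 / 2 := by
  have hzero : ∀ t ∈ Set.Ioi (0 : ℝ) \ Set.Ioc 0 M, max (M - t) 0 = 0 := by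
    rintro t ⟨h0, h1⟩
    refine max_eq_right ?_
    by_contra! h
    exact h1 ⟨h0, by linarith⟩
  have hcont : Continuous fun t : ℝ => max (M - t) 0 := by fun_prop
  constructor
  · exact (hcont.integrableOn_Ioc (a := 0) (b := M)).of_forall_sdiff_eq_zero measurableSet_Ioi hzero
  · rw [setIntegral_eq_of_subset_of_forall_sdiff_eq_zero measurableSet_Ioi
      (fun t ht => ht.1) hzero, ← intervalIntegral.integral_of_le hM]
    have hcongr : ∫ t in (0 : ℝ)..M, max (M - t) 0 = ∫ t in (0 : ℝ)..M, (M - t) := by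
      refine intervalIntegral.integral_congr fun t ht => ?_
      rw [Set.uIcc_of_le hM] at ht
      exact max_eq_left (by linarith [ht.2])
    rw [hcongr, intervalIntegral.integral_sub (by simp) (by simp)]
    simp
    ring

/-- The positive part of a `K`-Lipschitz function with a nonpositive value has integral at most
`K / 2` times the square of the length of the set where the function is positive. -/
theorem LipschitzWith.integral_posPart_le {K : ℝ≥0} (hK : 0 < K) {f : ℝ → ℝ}
    (hf : LipschitzWith K f) {a b c : ℝ} (hc : c ∈ Set.Ioc a b) (hfc : f c ≤ 0) :
    ∫ x in a..b, max (f x) 0 ≤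
      K / 2 * (volume.restrict (Set.Ioc a b)).real {x | 0 < f x} ^ 2 := by
  set μ := volume.restrict (Set.Ioc a b) with hμ
  set A := μ.real {x | 0 < f x} with hA
  have hK' : (0 : ℝ) < K := by exact_mod_cast hK
  have hcont := hf.continuous
  have hint : Integrable (fun x => max (f x) 0) μ :=
    (hcont.max continuous_const).integrableOn_Ioc
  have hM : 0 ≤ K * A := mul_nonneg hK'.le measureReal_nonneg
  have hlevel : ∀ t ∈ Set.Ioi (0 : ℝ),
      K * μ.real {x | t < max (f x) 0} ≤ max (K * A - t) 0 := by
    intro t ht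
    have ht : 0 < t := ht
    have hset : {x | t < max (f x) 0} = {x | t < f x} := by
      ext x
      simp [ht.le]
    rw [hset]
    have hmeas : MeasurableSet {x | t < f x} := measurableSet_lt measurable_const hcont.measurable
    by_cases hne : ∃ x ∈ Set.Ioc a b, t < f x
    · obtain ⟨x, hx, hfx⟩ := hne
      have hlow := hf.le_mul_measureReal_preimage_Ioc hc hfc hx hfx
      have hsplit : A = μ.real (f ⁻¹' Set.Ioc 0 t) + μ.real {x | t < f x} := by
        rw [← measureReal_union _ hmeas, hA]
        · congr 1
          ext x
          simp only [Set.mem_ofPred_eq, Set.mem_union, Set.mem_preimage, Set.mem_Ioc]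
          grind
        · rw [Set.disjoint_left]
          exact fun x hx hx' => absurd hx.2 (not_le.2 hx')
      refine le_max_of_le_left ?_
      rw [hsplit]
      linarith
    · have hempty : {x | t < f x} ∩ Set.Ioc a b = ∅ := by
        ext x
        simp only [Set.mem_inter_iff, Set.mem_ofPred_eq, Set.mem_empty_iff_false, iff_false]
        exact fun h => hne ⟨x, h.2, h.1⟩
      have : μ.real {x | t < f x} = 0 := by
        rw [hμ, measureReal_restrict_apply hmeas, hempty, measureReal_empty]
      rw [this, mul_zero]
      exact le_max_right _ _
  obtain ⟨hInt, hVal⟩ := integral_Ioi_max_sub_zero hM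
  have hmain : K * ∫ x, max (f x) 0 ∂μ ≤ (K * A) ^ 2 / 2 := by
    rw [hint.integral_eq_integral_meas_lt (ae_of_all _ fun x => le_max_right _ _),
      ← integral_const_mul, ← hVal]
    refine integral_mono_of_nonneg (ae_of_all _ fun t => ?_) hInt
      ((ae_restrict_iff' measurableSet_Ioi).2 (ae_of_all _ hlevel))
    exact mul_nonneg hK'.le measureReal_nonneg
  rw [intervalIntegral.integral_of_le (hc.1.le.trans hc.2)]
  refine le_of_mul_le_mul_left (hmain.trans_eq ?_) hK'
  ring

/-- Sharp `L¹` Poincaré inequality on an interval for Lipschitz functions of mean zero. -/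
theorem LipschitzWith.integral_abs_le_of_integral_eq_zero {K : ℝ≥0} (hK : 0 < K) {f : ℝ → ℝ}
    (hf : LipschitzWith K f) {a b : ℝ} (hab : a < b) (hzero : ∫ x in a..b, f x = 0) :
    ∫ x in a..b, |f x| ≤ K / 4 * (b - a) ^ 2 := by
  have hcont := hf.continuous
  have hK' : (0 : ℝ) < K := by exact_mod_cast hK
  have exists_nonpos : ∀ g : ℝ → ℝ, Continuous g → ∫ x in a..b, g x = 0 →
      ∃ c ∈ Set.Ioc a b, g c ≤ 0 := by
    intro g hg hg0
    by_contra! h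
    exact (intervalIntegral.intervalIntegral_pos_of_pos_on (hg.intervalIntegrable a b)
      (fun x hx => h x (Set.Ioo_subset_Ioc_self hx)) hab).ne' hg0
  obtain ⟨c, hc, hfc⟩ := exists_nonpos f hcont hzero
  obtain ⟨e, he, hfe⟩ := exists_nonpos (fun x => -f x) hcont.neg (by simp [hzero])
  have hpos := hf.integral_posPart_le hK hc hfc
  have hneg := hf.neg.integral_posPart_le hK he hfe
  simp only [Pi.neg_apply, Left.neg_pos_iff] at hneg
  set μ := volume.restrict (Set.Ioc a b) with hμ
  have hlen : μ.real {x | 0 < f x} + μ.real {x | f x < 0} ≤ b - a := by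
    rw [← measureReal_union _ (measurableSet_lt hcont.measurable measurable_const)]
    · refine (measureReal_mono (Set.subset_univ _)).trans_eq ?_
      simp [hμ, hab.le]
    · rw [Set.disjoint_left]
      exact fun x (hx : 0 < f x) (hx' : f x < 0) => lt_asymm hx hx'
  have hiP : IntervalIntegrable (fun x => max (f x) 0) volume a b :=
    (hcont.max continuous_const).intervalIntegrable a b
  have hiN : IntervalIntegrable (fun x => max (-f x) 0) volume a b :=
    (hcont.neg.max continuous_const).intervalIntegrable a b
  have habs : ∫ x in a..b, |f x| =
      (∫ x in a..b, max (f x) 0) + ∫ x in a..b, max (-f x) 0 := by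
    rw [← intervalIntegral.integral_add hiP hiN]
    exact intervalIntegral.integral_congr fun x _ => (max_zero_add_max_neg_zero_eq_abs_self _).symm
  have hdiff : (∫ x in a..b, max (f x) 0) - ∫ x in a..b, max (-f x) 0 = 0 := by
    rw [← intervalIntegral.integral_sub hiP hiN]
    refine Eq.trans (intervalIntegral.integral_congr fun x _ => ?_) hzero
    exact max_zero_sub_max_neg_zero_eq_self (f x)
  have hP : 0 ≤ μ.real {x | 0 < f x} := measureReal_nonneg
  have hN : 0 ≤ μ.real {x | f x < 0} := measureReal_nonneg
  rcases le_total (μ.real {x | 0 < f x}) (μ.real {x | f x < 0}) with h | h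
  · have hsq : μ.real {x | 0 < f x} ^ 2 ≤ ((b - a) / 2) ^ 2 :=
      pow_le_pow_left₀ hP (by linarith) 2
    nlinarith
  · have hsq : μ.real {x | f x < 0} ^ 2 ≤ ((b - a) / 2) ^ 2 :=
      pow_le_pow_left₀ hN (by linarith) 2
    nlinarith

/-- On an interval, the `L¹` distance from a Lipschitz function to a constant is at most the
difference of the masses plus a term quadratic in the length of the interval. -/
theorem LipschitzWith.integral_abs_const_sub_le {K : ℝ≥0} (hK : 0 < K) {f : ℝ → ℝ}
    (hf : LipschitzWith K f) {a b : ℝ} (hab : a < b) (q : ℝ) :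
    ∫ x in a..b, |q / (b - a) - f x| ≤
      |q - ∫ x in a..b, f x| + K / 4 * (b - a) ^ 2 := by
  have hpos : 0 < b - a := sub_pos.2 hab
  have hcont := hf.continuous
  set m := (∫ x in a..b, f x) / (b - a) with hm
  have hlip : LipschitzWith K fun x => f x - m :=
    LipschitzWith.of_dist_le_mul fun x y => by simpa using hf.dist_le_mul x y
  have hmean : ∫ x in a..b, (f x - m) = 0 := by
    rw [intervalIntegral.integral_sub (hcont.intervalIntegrable a b) (by simp),
      intervalIntegral.integral_const, smul_eq_mul, hm]
    field_simp
    ring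
  have hdev := hlip.integral_abs_le_of_integral_eq_zero hK hab hmean
  have hint : IntervalIntegrable (fun x => |f x - m|) volume a b :=
    (hcont.sub continuous_const).abs.intervalIntegrable a b
  have htri : ∫ x in a..b, |q / (b - a) - f x| ≤
      ∫ x in a..b, (|q / (b - a) - m| + |f x - m|) := by
    refine intervalIntegral.integral_mono_on hab.le
      ((continuous_const.sub hcont).abs.intervalIntegrable a b)
      ((by simp : IntervalIntegrable (fun _ => |q / (b - a) - m|) volume a b).add hint) ?_
    intro x _
    rw [abs_sub_comm (f x) m]
    exact abs_sub_le _ _ _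
  rw [intervalIntegral.integral_add (by simp) hint, intervalIntegral.integral_const,
    smul_eq_mul, hm, ← sub_div, abs_div, abs_of_pos hpos, mul_div_cancel₀ _ hpos.ne'] at htri
  linarith

/-- Histogram approximation: if `d` is a density on `[0,1]` with `|d x - d y| ≤ 2C|x - y|`,
`[0,1]` is partitioned into `r` bins of width `ℓ = 1/r` (with `I_1 = [0,ℓ]` and
`I_s = ((s-1)ℓ, sℓ]` for `s ≥ 2`), and `p` is the piecewise-constant density with value
`p_s/ℓ` on bin `I_s` where the `p_s` are nonnegative and sum to `1`, then
`(1/2)∫_0^1 |p - d| ≤ (1/2)∑_s |p_s - ∫_{I_s} d| + Cℓ/4`. -/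
theorem histogram_tv_error_bound
    (C : ℝ) (hC : 0 < C) (d : ℝ → ℝ)
    (hd0 : ∀ z ∈ Set.Icc (0:ℝ) 1, 0 ≤ d z)
    (hd1 : ∫ z in (0:ℝ)..1, d z = 1)
    (hLip : ∀ x ∈ Set.Icc (0:ℝ) 1, ∀ y ∈ Set.Icc (0:ℝ) 1, |d x - d y| ≤ 2 * C * |x - y|)
    (r : ℕ) (hr : 0 < r) (ℓ : ℝ) (hℓ : ℓ = 1 / r)
    (I : Fin r → Set ℝ)
    (hI : ∀ s : Fin r, I s = if (s : ℕ) = 0 then Set.Icc 0 ℓ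
          else Set.Ioc (((s : ℕ) : ℝ) * ℓ) ((((s : ℕ) : ℝ) + 1) * ℓ))
    (ps : Fin r → ℝ) (hps0 : ∀ s, 0 ≤ ps s) (hps1 : ∑ s, ps s = 1)
    (p : ℝ → ℝ) (hp : ∀ s : Fin r, ∀ z ∈ I s, p z = ps s / ℓ) :
    (1 / 2) * ∫ z in (0:ℝ)..1, |p z - d z|
      ≤ (1 / 2) * ∑ s : Fin r, |ps s - ∫ z in I s, d z| + C * ℓ / 4 := by
  have hr' : (0 : ℝ) < r := by exact_mod_cast hr
  have hℓ0 : 0 < ℓ := by rw [hℓ]; positivity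
  have hrℓ : (r : ℝ) * ℓ = 1 := by rw [hℓ]; field_simp
  obtain ⟨g, hg, hdg⟩ : ∃ g : ℝ → ℝ, LipschitzWith (2 * C).toNNReal g ∧
      Set.EqOn d g (Set.Icc 0 1) := by
    refine LipschitzOnWith.extend_real (LipschitzOnWith.of_dist_le_mul fun x hx y hy => ?_)
    rw [Real.coe_toNNReal _ (by positivity), Real.dist_eq, Real.dist_eq]
    exact hLip x hx y hy
  set bin : ℕ → ℝ := fun k => k * ℓ with hbin
  have hwidth : ∀ k, bin (k + 1) - bin k = ℓ := fun k => by
    simp only [hbin]; push_cast; ring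
  have hlt : ∀ k, bin k < bin (k + 1) := fun k => by linarith [hwidth k]
  have hsub : ∀ k < r, Set.Icc (bin k) (bin (k + 1)) ⊆ Set.Icc 0 1 := fun k hk => by
    refine Set.Icc_subset_Icc (by simp only [hbin]; positivity) ?_
    rw [← hrℓ]
    exact mul_le_mul_of_nonneg_right (by exact_mod_cast hk) hℓ0.le
  have hIoc : ∀ s : Fin r, Set.Ioc (bin s) (bin (s + 1)) ⊆ I s := fun s x hx => by
    rw [hI]
    split_ifs with h
    · simp only [h, hbin] at hx
      simpa using Set.Ioc_subset_Icc_self hx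
    · simpa [hbin] using hx
  have hmass : ∀ s : Fin r, ∫ z in I s, d z = ∫ z in bin s..bin (s + 1), g z := fun s => by
    have hIs : ∫ z in I s, d z = ∫ z in Set.Ioc (bin s) (bin (s + 1)), d z := by
      rw [hI]
      split_ifs with h
      · rw [integral_Icc_eq_integral_Ioc]
        simp [h, hbin]
      · simp [hbin]
    rw [hIs, intervalIntegral.integral_of_le (hlt s).le]
    exact setIntegral_congr_fun measurableSet_Ioc
      fun x hx => hdg (hsub s s.2 (Set.Ioc_subset_Icc_self hx))
  have hcongr : ∀ s : Fin r, Set.EqOn (fun z => |ps s / ℓ - g z|) (fun z => |p z - d z|)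
      (Set.uIoc (bin s) (bin (s + 1))) := fun s x hx => by
    rw [Set.uIoc_of_le (hlt s).le] at hx
    simp only [hp s x (hIoc s hx), hdg (hsub s s.2 (Set.Ioc_subset_Icc_self hx))]
  have hint : ∀ k < r, IntervalIntegrable (fun z => |p z - d z|) volume (bin k) (bin (k + 1)) :=
    fun k hk => ((continuous_const.sub hg.continuous).abs.intervalIntegrable _ _).congr
      (hcongr ⟨k, hk⟩)
  have hbound : ∀ s : Fin r, ∫ z in bin s..bin (s + 1), |p z - d z| ≤
      |ps s - ∫ z in I s, d z| + C / 2 * ℓ ^ 2 := fun s => by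
    have h := hg.integral_abs_const_sub_le (by simpa using hC) (hlt s) (ps s)
    rw [hwidth, Real.coe_toNNReal _ (by positivity)] at h
    have heq := intervalIntegral.integral_congr_ae (μ := volume)
      (ae_of_all _ fun x hx => hcongr s hx)
    rw [hmass, ← heq]
    linarith
  have hsum : ∫ z in (0 : ℝ)..1, |p z - d z| =
      ∑ s : Fin r, ∫ z in bin s..bin (s + 1), |p z - d z| := by
    rw [← Finset.sum_range fun k => ∫ z in bin k..bin (k + 1), |p z - d z|,
      intervalIntegral.sum_integral_adjacent_intervals hint]
    simp [hbin, hrℓ]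
  have htotal := Finset.sum_le_sum fun s (_ : s ∈ Finset.univ) => hbound s
  rw [← hsum, Finset.sum_add_distrib, Finset.sum_const, Finset.card_univ, Fintype.card_fin,
    nsmul_eq_mul] at htotal
  have hscale : (r : ℝ) * (C / 2 * ℓ ^ 2) = C / 2 * ℓ := by
    linear_combination C / 2 * ℓ * hrℓ
  linarith
end

section
/- Let D be a probability distribution on ℝ with density d satisfying |d(x) − d(y)| ≤ 2C|x − y| for all x, y and d(z) ≤ β·e^{−λ|z|} for all z, with constants C, β, λ > 0. Fix L > 0 and ℓ > 0 with 2L/ℓ an integer, and partition [−L, L] into bins I_s = (−L + (s−1)ℓ, −L + sℓ] for s = 1, …, 2L/ℓ (with I_1 containing −L), and set I_− = (−∞, −L), I_+ = (L, ∞). Let p_−, p_1, …, p_{2L/ℓ}, p_+ be nonnegative reals summing to 1, and let p be the density with p(z) = p_s/ℓ for z ∈ I_s, p(z) = p_+·λ·e^{−λ(z−L)} for z > L, and p(z) = p_−·λ·e^{λ(z+L)} for z < −L. Then Λ_TV(p, d) ≤ (2β/λ)·e^{−λL} + C·L·ℓ/2 + (1/2)·∑_{s ∈ {−, 1, …, 2L/ℓ,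 +}} |p_s − D(I_s)|, where D(I_s) = ∫_{I_s} d(z) dz. -/
open MeasureTheory
open scoped NNReal ENNReal

/-- By symmetry, `{(x, y) | h y < h x}` has at most half the mass of the product `ν × ν`. -/
theorem two_mul_lintegral_measure_lt_le {α : Type*} [MeasurableSpace α] (ν : Measure α)
    [IsFiniteMeasure ν]
    {h : α → ℝ} (hh : Measurable h) :
    2 * ∫⁻ x, ν {y | h y < h x} ∂ν ≤ ν Set.univ ^ 2 := by
  have hS : MeasurableSet {q : α × α | h q.2 < h q.1} :=
    measurableSet_lt (hh.comp measurable_snd) (hh.comp measurable_fst)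
  have hT : MeasurableSet {q : α × α | h q.1 < h q.2} :=
    measurableSet_lt (hh.comp measurable_fst) (hh.comp measurable_snd)
  have h1 : (ν.prod ν) {q : α × α | h q.2 < h q.1} = ∫⁻ x, ν {y | h y < h x} ∂ν :=
    Measure.prod_apply hS
  have h2 : (ν.prod ν) {q : α × α | h q.1 < h q.2} = ∫⁻ x, ν {y | h y < h x} ∂ν :=
    Measure.prod_apply_symm hT
  have hdisj : Disjoint {q : α × α | h q.2 < h q.1} {q : α × α | h q.1 < h q.2} :=
    Set.disjoint_left.2 fun q (hq : h q.2 < h q.1) (hq' : h q.1 < h q.2) => lt_asymm hq hq'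
  calc 2 * ∫⁻ x, ν {y | h y < h x} ∂ν
      = (ν.prod ν) ({q : α × α | h q.2 < h q.1} ∪ {q : α × α | h q.1 < h q.2}) := by
        rw [measure_union hdisj hT, h1, h2, two_mul]
    _ ≤ (ν.prod ν) Set.univ := measure_mono (Set.subset_univ _)
    _ = ν Set.univ ^ 2 := by rw [← Set.univ_prod_univ, Measure.prod_prod, sq]

/-- A `K`-Lipschitz function that climbs from a nonpositive value to `h x` within `J` spends
measure at least `h x / K` at values strictly between `0` and `h x`. -/
theorem ofReal_le_volume_of_lipschitz {h : ℝ → ℝ} {K : ℝ≥0} (hh : LipschitzWith K h)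
    {J : Set ℝ} (hJ : IsPreconnected J) {c x : ℝ} (hc : c ∈ J) (hx : x ∈ J) (hc0 : h c ≤ 0) :
    ENNReal.ofReal (h x) ≤ K * volume ({y | 0 < h y ∧ h y < h x} ∩ J) := by
  have hsub : Set.Ioo 0 (h x) ⊆ h '' ({y | 0 < h y ∧ h y < h x} ∩ J) := by
    intro t ht
    obtain ⟨y, hy, rfl⟩ := hJ.intermediate_value hc hx hh.continuous.continuousOn
      ⟨hc0.trans ht.1.le, ht.2.le⟩
    exact ⟨y, ⟨ht, hy⟩, rfl⟩
  have := (hh.lipschitzOnWith (s := {y | 0 < h y ∧ h y < h x} ∩ J)).hausdorffMeasure_image_le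
    zero_le_one
  rw [hausdorffMeasure_real, ENNReal.rpow_one] at this
  calc ENNReal.ofReal (h x) = volume (Set.Ioo 0 (h x)) := by simp
    _ ≤ _ := (measure_mono hsub).trans this

/-- A `K`-Lipschitz function that is nonpositive somewhere on an interval `J` and positive on a
subset of measure `m` satisfies `∫_J h⁺ ≤ K m² / 2`. -/
theorem two_mul_integral_posPart_le {h : ℝ → ℝ} {K : ℝ≥0} (hh : LipschitzWith K h)
    {J : Set ℝ} (hJ : IsPreconnected J) (hJm : MeasurableSet J) (hJf : volume J ≠ ∞)
    {c : ℝ} (hc : c ∈ J) (hc0 : h c ≤ 0) :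
    2 * ∫ x in J, max (h x) 0 ≤ K * volume.real ({y | 0 < h y} ∩ J) ^ 2 := by
  have hm : Measurable h := hh.continuous.measurable
  have hPm : MeasurableSet {y | 0 < h y} := measurableSet_lt measurable_const hm
  set ν := volume.restrict ({y | 0 < h y} ∩ J) with hν
  have hfin : volume ({y | 0 < h y} ∩ J) ≠ ∞ := measure_ne_top_of_subset Set.inter_subset_right hJf
  have : IsFiniteMeasure ν := ⟨by simpa [hν] using hfin.lt_top⟩
  have hle : 2 * ∫⁻ x in J, ENNReal.ofReal (max (h x) 0)
      ≤ K * volume ({y | 0 < h y} ∩ J) ^ 2 := by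
    have e1 : ∫⁻ x in J, ENNReal.ofReal (max (h x) 0) = ∫⁻ x, ENNReal.ofReal (h x) ∂ν := by
      rw [hν, ← Measure.restrict_restrict hPm, ← lintegral_indicator hPm]
      refine lintegral_congr fun x => ?_
      by_cases hx : 0 < h x
      · simp [hx, hx.le]
      · simp [hx, not_lt.1 hx]
    have e2 : ∫⁻ x, ENNReal.ofReal (h x) ∂ν ≤ ∫⁻ x, K * ν {y | h y < h x} ∂ν := by
      refine lintegral_mono_ae ?_
      filter_upwards [ae_restrict_mem (hPm.inter hJm)] with x hx
      refine (ofReal_le_volume_of_lipschitz hh hJ hc hx.2 hc0).trans_eq ?_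
      rw [hν, Measure.restrict_apply (measurableSet_lt hm measurable_const)]
      congr 2
      ext y
      simp only [Set.mem_inter_iff, Set.mem_ofPred_eq]
      tauto
    rw [lintegral_const_mul' _ _ ENNReal.coe_ne_top] at e2
    calc 2 * ∫⁻ x in J, ENNReal.ofReal (max (h x) 0)
        ≤ 2 * (K * ∫⁻ x, ν {y | h y < h x} ∂ν) := by rw [e1]; gcongr
      _ = K * (2 * ∫⁻ x, ν {y | h y < h x} ∂ν) := by ring
      _ ≤ K * ν Set.univ ^ 2 := by gcongr; exact two_mul_lintegral_measure_lt_le ν hm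
      _ = _ := by simp [hν]
  rw [integral_eq_lintegral_of_nonneg_ae (f := fun x => max (h x) 0)
    (ae_of_all _ fun x => le_max_right _ _)
    (hm.max measurable_const).aestronglyMeasurable]
  have := ENNReal.toReal_mono (ENNReal.mul_ne_top ENNReal.coe_ne_top (ENNReal.pow_ne_top hfin)) hle
  simpa [Measure.real] using this

/-- Sharp `L¹` Poincaré inequality for mean-zero Lipschitz functions on an interval. -/
theorem integral_abs_le_of_lipschitz_of_integral_eq_zero {h : ℝ → ℝ} {K : ℝ≥0}
    (hh : LipschitzWith K h) {u v : ℝ} (huv : u < v) (h0 : ∫ x in Set.Ioc u v, h x = 0) :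
    ∫ x in Set.Ioc u v, |h x| ≤ K * (v - u) ^ 2 / 4 := by
  set J := Set.Ioc u v with hJ
  have hm : Measurable h := hh.continuous.measurable
  have hvol : volume J ≠ 0 := by simp [hJ, huv]
  have hvolf : volume J ≠ ∞ := by simp [hJ]
  have hint : IntegrableOn h J :=
    (hh.continuous.integrableOn_Icc (a := u) (b := v)).mono_set Set.Ioc_subset_Icc_self
  have hposInt : IntegrableOn (fun x => max (h x) 0) J := hint.pos_part
  have hnegInt : IntegrableOn (fun x => max (-h x) 0) J := hint.neg_part
  obtain ⟨c, hcJ, hc⟩ := exists_le_setAverage hvol hvolf hint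
  obtain ⟨c', hcJ', hc'⟩ := exists_setAverage_le hvol hvolf hint
  rw [setAverage_eq, h0, smul_zero] at hc hc'
  have hP := two_mul_integral_posPart_le hh (J := J) isPreconnected_Ioc measurableSet_Ioc hvolf hcJ hc
  have hN := two_mul_integral_posPart_le (h := fun x => -h x) hh.neg (J := J) isPreconnected_Ioc
    measurableSet_Ioc hvolf hcJ' (by simpa using hc')
  have habs : ∫ x in J, |h x| = (∫ x in J, max (h x) 0) + ∫ x in J, max (-h x) 0 := by
    rw [← integral_add hposInt hnegInt]
    refine integral_congr_ae (ae_of_all _ fun x => ?_)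
    simp only [max_zero_add_max_neg_zero_eq_abs_self]
  have hdiff : (∫ x in J, max (h x) 0) - ∫ x in J, max (-h x) 0 = 0 := by
    rw [← integral_sub hposInt hnegInt]
    refine Eq.trans ?_ h0
    refine integral_congr_ae (ae_of_all _ fun x => ?_)
    rcases le_total 0 (h x) with hx | hx <;> simp [hx]
  have hmn : volume.real ({y | 0 < h y} ∩ J) + volume.real ({y | 0 < -h y} ∩ J) ≤ v - u := by
    rw [← measureReal_union]
    · refine (measureReal_mono (s₂ := J) ?_ hvolf).trans_eq (by simp [hJ, huv.le])
      exact Set.union_subset Set.inter_subset_right Set.inter_subset_right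
    · refine Set.disjoint_left.2 fun x hx hx' => ?_
      have := hx.1
      have := hx'.1
      simp only [Set.mem_ofPred_eq] at *
      linarith
    · exact (measurableSet_lt measurable_const hm.neg).inter measurableSet_Ioc
  have hm0 : 0 ≤ volume.real ({y | 0 < h y} ∩ J) := measureReal_nonneg
  have hn0 : 0 ≤ volume.real ({y | 0 < -h y} ∩ J) := measureReal_nonneg
  generalize volume.real ({y | 0 < h y} ∩ J) = m at *
  generalize volume.real ({y | 0 < -h y} ∩ J) = n at *
  have key : ∀ t : ℝ, 0 ≤ t → t ≤ (v - u) / 2 → K * t ^ 2 ≤ K * (v - u) ^ 2 / 4 := by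
    intro t ht ht'
    calc K * t ^ 2 ≤ K * ((v - u) / 2) ^ 2 := by gcongr
      _ = _ := by ring
  rcases le_total m n with hle | hle
  · linarith [key m hm0 (by linarith)]
  · linarith [key n hn0 (by linarith)]

/-- `L¹` error of approximating a Lipschitz function by the constant `q / (v - u)` on `(u, v]`. -/
theorem integral_abs_const_sub_le_of_lipschitz {d : ℝ → ℝ} {K : ℝ≥0} (hd : LipschitzWith K d)
    {u v : ℝ} (huv : u < v) (q : ℝ) :
    ∫ x in Set.Ioc u v, |q / (v - u) - d x|
      ≤ |q - ∫ x in Set.Ioc u v, d x| + K * (v - u) ^ 2 / 4 := by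
  set D := ∫ x in Set.Ioc u v, d x with hD
  have hpos : 0 < v - u := sub_pos.2 huv
  have hdInt : IntegrableOn d (Set.Ioc u v) :=
    (hd.continuous.integrableOn_Icc (a := u) (b := v)).mono_set Set.Ioc_subset_Icc_self
  have hconst (a : ℝ) : IntegrableOn (fun _ => a) (Set.Ioc u v) := by simp
  have hlip : LipschitzWith K fun x => d x - D / (v - u) :=
    LipschitzWith.of_dist_le_mul fun x y => by simpa using hd.dist_le_mul x y
  have h0 : ∫ x in Set.Ioc u v, (d x - D / (v - u)) = 0 := by
    rw [integral_sub hdInt (hconst _), ← hD]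
    simp [huv.le]
    field_simp
    simp
  have hfluct := integral_abs_le_of_lipschitz_of_integral_eq_zero hlip huv h0
  have hfluctInt : IntegrableOn (fun x => |d x - D / (v - u)|) (Set.Ioc u v) :=
    (hdInt.sub (hconst _)).abs
  calc ∫ x in Set.Ioc u v, |q / (v - u) - d x|
      ≤ ∫ x in Set.Ioc u v, (|q - D| / (v - u) + |d x - D / (v - u)|) := by
        refine integral_mono ((hconst _).sub hdInt).abs ((hconst _).add hfluctInt) fun x => ?_
        have := abs_sub_le (q / (v - u)) (D / (v - u)) (d x)
        rw [← sub_div, abs_div, abs_of_pos hpos, abs_sub_comm (D / (v - u))] at this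
        exact this
    _ = |q - D| + ∫ x in Set.Ioc u v, |d x - D / (v - u)| := by
        rw [integral_add (hconst _) hfluctInt]
        simp [huv.le]
        field_simp
    _ ≤ _ := by gcongr

theorem setIntegral_abs_sub_le {f d : ℝ → ℝ} {S : Set ℝ} (hf : IntegrableOn f S)
    (hd : IntegrableOn d S) (hf0 : ∀ x, 0 ≤ f x) (hd0 : ∀ x, 0 ≤ d x) {B : ℝ}
    (hB : ∫ x in S, d x ≤ B) :
    ∫ x in S, |f x - d x| ≤ |(∫ x in S, f x) - ∫ x in S, d x| + 2 * B := by
  have : ∫ x in S, |f x - d x| ≤ ∫ x in S, (f x + d x) :=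
    integral_mono (hf.sub hd).abs (hf.add hd) fun x => by
      rw [abs_le]; constructor <;> linarith [hf0 x, hd0 x]
  rw [integral_add hf hd] at this
  linarith [le_abs_self ((∫ x in S, f x) - ∫ x in S, d x)]

theorem integral_expTail_Ioi {lam : ℝ} (hlam : 0 < lam) (a L : ℝ) :
    IntegrableOn (fun z => a * Real.exp (-lam * (z - L))) (Set.Ioi L) ∧
      ∫ z in Set.Ioi L, a * Real.exp (-lam * (z - L)) = a / lam := by
  have e : ∀ z, a * Real.exp (-lam * (z - L)) = (a * Real.exp (lam * L)) * Real.exp (-lam * z) :=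
    fun z => by rw [mul_assoc, ← Real.exp_add]; ring_nf
  simp only [e]
  refine ⟨(integrableOn_exp_mul_Ioi (neg_lt_zero.2 hlam) L).const_mul _, ?_⟩
  rw [integral_const_mul, integral_exp_mul_Ioi (neg_lt_zero.2 hlam), neg_div_neg_eq, mul_div_assoc',
    mul_assoc, ← Real.exp_add]
  simp

theorem integral_expTail_Iic {lam : ℝ} (hlam : 0 < lam) (a L : ℝ) :
    IntegrableOn (fun z => a * Real.exp (lam * (z + L))) (Set.Iic (-L)) ∧
      ∫ z in Set.Iic (-L), a * Real.exp (lam * (z + L)) = a / lam := by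
  have e : ∀ z, a * Real.exp (lam * (z + L)) = (a * Real.exp (lam * L)) * Real.exp (lam * z) :=
    fun z => by rw [mul_assoc, ← Real.exp_add]; ring_nf
  simp only [e]
  refine ⟨(integrableOn_exp_mul_Iic hlam (-L)).const_mul _, ?_⟩
  rw [integral_const_mul, integral_exp_mul_Iic hlam, mul_div_assoc', mul_assoc, ← Real.exp_add]
  simp

/-- Histogram-plus-exponential-tails approximation on `ℝ`: if the density `d` is
`2C`-Lipschitz with `d z ≤ β e^{-λ|z|}`, `[-L, L]` is partitioned into `2L/ℓ` bins of width
`ℓ` and the density `p` is constant `p_s/ℓ` on the bin `I_s`, equal to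
`p_+ λ e^{-λ(z-L)}` on `(L, ∞)` and `p_- λ e^{λ(z+L)}` on `(-∞, -L)`, then
`Λ_TV(p, d) ≤ (2β/λ)e^{-λL} + CLℓ/2 + (1/2)∑_s |p_s - D(I_s)|`, where the sum runs over
all bins including the two tails. -/
theorem tail_histogram_tv_error_bound
    (C β lam : ℝ) (hC : 0 < C) (hβ : 0 < β) (hlam : 0 < lam)
    (d : ℝ → ℝ) (hd0 : ∀ z, 0 ≤ d z) (hdInt : Integrable d) (hd1 : ∫ z, d z = 1)
    (hLip : ∀ x y : ℝ, |d x - d y| ≤ 2 * C * |x - y|)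
    (hdecay : ∀ z : ℝ, d z ≤ β * Real.exp (-lam * |z|))
    (L ℓ : ℝ) (hL : 0 < L) (hℓ : 0 < ℓ)
    (r : ℕ) (hr : (r : ℝ) * ℓ = 2 * L)
    (I : Fin r → Set ℝ)
    (hI : ∀ s : Fin r, I s = if (s : ℕ) = 0 then Set.Icc (-L) (-L + ℓ)
          else Set.Ioc (-L + ((s : ℕ) : ℝ) * ℓ) (-L + (((s : ℕ) : ℝ) + 1) * ℓ))
    (pm pp : ℝ) (ps : Fin r → ℝ)
    (hpm : 0 ≤ pm) (hpp : 0 ≤ pp) (hps : ∀ s, 0 ≤ ps s)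
    (hsum : pm + (∑ s, ps s) + pp = 1)
    (p : ℝ → ℝ)
    (hpbin : ∀ s : Fin r, ∀ z ∈ I s, p z = ps s / ℓ)
    (hpplus : ∀ z : ℝ, L < z → p z = pp * lam * Real.exp (-lam * (z - L)))
    (hpminus : ∀ z : ℝ, z < -L → p z = pm * lam * Real.exp (lam * (z + L))) :
    (1 / 2) * ∫ z, |p z - d z|
      ≤ (2 * β / lam) * Real.exp (-lam * L) + C * L * ℓ / 2
        + (1 / 2) * (|pm - ∫ z in Set.Iio (-L), d z|
            + (∑ s : Fin r, |ps s - ∫ z in I s, d z|)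
            + |pp - ∫ z in Set.Ioi L, d z|) := by
  have hLipW : LipschitzWith (Real.toNNReal (2 * C)) d := LipschitzWith.of_dist_le_mul fun x y => by
    rw [Real.coe_toNNReal _ (by positivity), Real.dist_eq, Real.dist_eq]
    exact hLip x y
  set a : ℕ → ℝ := fun k => -L + k * ℓ with ha
  have ha_succ (k : ℕ) : a (k + 1) - a k = ℓ := by simp only [ha]; push_cast; ring
  have ha_lt (k : ℕ) : a k < a (k + 1) := by linarith [ha_succ k]
  have ha_zero : a 0 = -L := by simp [ha]
  have ha_last : a r = L := by simp only [ha]; linarith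
  have hIoc (s : Fin r) : Set.Ioc (a s) (a (s + 1)) ⊆ I s := by
    rw [hI s]
    split_ifs with h
    · rw [h, ha_zero]
      simpa [ha] using Set.Ioc_subset_Icc_self
    · simp [ha]
  have hIae (s : Fin r) : I s =ᵐ[volume] Set.Ioc (a s) (a (s + 1)) := by
    rw [hI s]
    split_ifs with h
    · rw [h, ha_zero]
      simpa [ha] using Ioc_ae_eq_Icc.symm
    · simp only [ha, Nat.cast_add, Nat.cast_one]
      exact Filter.EventuallyEq.rfl
  have hbin (s : Fin r) :
      IntegrableOn (fun z => |p z - d z|) (Set.Ioc (a s) (a (s + 1))) ∧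
        ∫ z in Set.Ioc (a s) (a (s + 1)), |p z - d z|
          ≤ |ps s - ∫ z in I s, d z| + C * ℓ ^ 2 / 2 := by
    have hp : Set.EqOn (fun z => |ps s / ℓ - d z|) (fun z => |p z - d z|)
        (Set.Ioc (a s) (a (s + 1))) := fun z hz => by
      simp only [hpbin s z (hIoc s hz)]
    refine ⟨IntegrableOn.congr_fun ?_ hp measurableSet_Ioc, ?_⟩
    · exact ((integrableOn_const (by simp)).sub hdInt.integrableOn).abs
    · rw [← setIntegral_congr_fun measurableSet_Ioc hp, setIntegral_congr_set (hIae s)]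
      have := integral_abs_const_sub_le_of_lipschitz hLipW (ha_lt s) (ps s)
      rw [ha_succ, Real.coe_toNNReal _ (by positivity)] at this
      linarith
  obtain ⟨hbInt, hbVal⟩ : IntegrableOn (fun z => |p z - d z|) (Set.Ioc (-L) L) ∧
      ∫ z in Set.Ioc (-L) L, |p z - d z|
        ≤ (∑ s : Fin r, |ps s - ∫ z in I s, d z|) + C * L * ℓ := by
    have hint : ∀ k < r, IntervalIntegrable (fun z => |p z - d z|) volume (a k) (a (k + 1)) :=
      fun k hk => (intervalIntegrable_iff_integrableOn_Ioc_of_le (ha_lt k).le).2 (hbin ⟨k, hk⟩).1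
    have hLL : -L ≤ L := by linarith
    constructor
    · rw [← intervalIntegrable_iff_integrableOn_Ioc_of_le hLL, ← ha_zero, ← ha_last]
      exact IntervalIntegrable.trans_iterate hint
    · rw [← intervalIntegral.integral_of_le hLL]
      have hsplit := intervalIntegral.sum_integral_adjacent_intervals hint
      rw [ha_zero, ha_last] at hsplit
      rw [← hsplit, Finset.sum_range]
      calc _ ≤ ∑ s : Fin r, (|ps s - ∫ z in I s, d z| + C * ℓ ^ 2 / 2) := by
            refine Finset.sum_le_sum fun s _ => ?_
            rw [intervalIntegral.integral_of_le (ha_lt s).le]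
            exact (hbin s).2
        _ = _ := by
            rw [Finset.sum_add_distrib, Finset.sum_const, Finset.card_univ, Fintype.card_fin,
              nsmul_eq_mul]
            linear_combination C * ℓ / 2 * hr
  obtain ⟨hrInt, hrVal⟩ : IntegrableOn (fun z => |p z - d z|) (Set.Ioi L) ∧
      ∫ z in Set.Ioi L, |p z - d z|
        ≤ |pp - ∫ z in Set.Ioi L, d z| + 2 * (β / lam * Real.exp (-lam * L)) := by
    obtain ⟨hi, hv⟩ := integral_expTail_Ioi hlam (pp * lam) L
    obtain ⟨hi', hv'⟩ := integral_expTail_Ioi hlam (β * Real.exp (-lam * L)) L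
    have hp : Set.EqOn (fun z => |pp * lam * Real.exp (-lam * (z - L)) - d z|)
        (fun z => |p z - d z|) (Set.Ioi L) := fun z hz => by simp only [hpplus z hz]
    refine ⟨IntegrableOn.congr_fun (hi.sub hdInt.integrableOn).abs hp measurableSet_Ioi, ?_⟩
    have hmass : ∫ z in Set.Ioi L, d z ≤ β / lam * Real.exp (-lam * L) := by
      rw [div_mul_eq_mul_div, ← hv']
      refine setIntegral_mono_on hdInt.integrableOn hi' measurableSet_Ioi fun z hz => ?_
      have hz' : L < z := hz
      refine (hdecay z).trans_eq ?_
      rw [abs_of_pos (hL.trans hz'), mul_assoc, ← Real.exp_add]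
      ring_nf
    rw [← setIntegral_congr_fun measurableSet_Ioi hp]
    have := setIntegral_abs_sub_le hi hdInt.integrableOn (fun z => by positivity) hd0 hmass
    rwa [hv, mul_div_cancel_right₀ _ hlam.ne'] at this
  obtain ⟨hlInt, hlVal⟩ : IntegrableOn (fun z => |p z - d z|) (Set.Iic (-L)) ∧
      ∫ z in Set.Iic (-L), |p z - d z|
        ≤ |pm - ∫ z in Set.Iio (-L), d z| + 2 * (β / lam * Real.exp (-lam * L)) := by
    obtain ⟨hi, hv⟩ := integral_expTail_Iic hlam (pm * lam) L
    obtain ⟨hi', hv'⟩ := integral_expTail_Iic hlam (β * Real.exp (-lam * L)) L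
    rw [integrableOn_Iic_iff_integrableOn_Iio] at hi hi' ⊢
    rw [integral_Iic_eq_integral_Iio] at hv hv' ⊢
    have hp : Set.EqOn (fun z => |pm * lam * Real.exp (lam * (z + L)) - d z|)
        (fun z => |p z - d z|) (Set.Iio (-L)) := fun z hz => by simp only [hpminus z hz]
    refine ⟨IntegrableOn.congr_fun (hi.sub hdInt.integrableOn).abs hp measurableSet_Iio, ?_⟩
    have hmass : ∫ z in Set.Iio (-L), d z ≤ β / lam * Real.exp (-lam * L) := by
      rw [div_mul_eq_mul_div, ← hv']
      refine setIntegral_mono_on hdInt.integrableOn hi' measurableSet_Iio fun z hz => ?_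
      have hz' : z < -L := hz
      refine (hdecay z).trans_eq ?_
      rw [abs_of_neg (by linarith), mul_assoc, ← Real.exp_add]
      ring_nf
    rw [← setIntegral_congr_fun measurableSet_Iio hp]
    have := setIntegral_abs_sub_le hi hdInt.integrableOn (fun z => by positivity) hd0 hmass
    rwa [hv, mul_div_cancel_right₀ _ hlam.ne'] at this
  have hright : IntegrableOn (fun z => |p z - d z|) (Set.Ioi (-L)) := by
    rw [← Set.Ioc_union_Ioi_eq_Ioi (by linarith : -L ≤ L)]
    exact hbInt.union hrInt
  have hsplit : ∫ z, |p z - d z| = (∫ z in Set.Iic (-L), |p z - d z|)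
      + ((∫ z in Set.Ioc (-L) L, |p z - d z|) + ∫ z in Set.Ioi L, |p z - d z|) := by
    rw [← setIntegral_union (Set.Ioc_disjoint_Ioi le_rfl) measurableSet_Ioi hbInt hrInt,
      Set.Ioc_union_Ioi_eq_Ioi (by linarith : -L ≤ L),
      intervalIntegral.integral_Iic_add_Ioi hlInt hright]
  have hcoef : 2 * β / lam * Real.exp (-lam * L) = 2 * (β / lam * Real.exp (-lam * L)) := by ring
  rw [hsplit, hcoef]
  linarith
end
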